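/- For all sufficiently large positive integers n, if k denotes the integer k = ⌈0.6 · √(log n / log log n)⌉, then f(n, k²·n) > f(n, n) + 0.36 · n · log n / log log n. (Here log denotes the natural logarithm.) -/

import Mathlib

open Real

/-- `f n m` is the least nonnegative integer `L` such that the interval `(m, m + L]`
contains `n` distinct integers `a 1, ..., a n` with `i ∣ a i` for all `1 ≤ i ≤ n`. -/
noncomputable def f (n m : ℕ) : ℕ :=
  sInf {L : ℕ | ∃ a : ℕ → ℕ,
    (∀ i ∈ Finset.Icc 1 n, i ∣ a i) ∧
    (∀ i ∈ Finset.Icc 1 n, m < a i ∧ a i ≤ m + L) ∧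
    Set.InjOn a (Finset.Icc 1 n)}

/-- A valid choice of multiples of `1, ..., n` in `(m, m + f n m]`. -/
lemma exists_multiples_of_f (n m : ℕ) : ∃ a : ℕ → ℕ,
    (∀ i ∈ Finset.Icc 1 n, i ∣ a i) ∧
    (∀ i ∈ Finset.Icc 1 n, m < a i ∧ a i ≤ m + f n m) ∧
    Set.InjOn a (Finset.Icc 1 n) := by
  refine Nat.sInf_mem (s := {L : ℕ | ∃ a : ℕ → ℕ,
    (∀ i ∈ Finset.Icc 1 n, i ∣ a i) ∧
    (∀ i ∈ Finset.Icc 1 n, m < a i ∧ a i ≤ m + L) ∧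
    Set.InjOn a (Finset.Icc 1 n)}) ?_
  refine ⟨(m + 1) * n, fun i => (m + 1) * i, ?_, ?_, ?_⟩
  · intro i _
    exact Dvd.intro_left _ rfl
  · intro i hi
    rw [Finset.mem_Icc] at hi
    constructor <;> nlinarith
  · intro i _ j _ h
    exact Nat.eq_of_mul_eq_mul_left (Nat.succ_pos m) h

lemma card_smoothNumbersUpTo_mono {M N : ℕ} (h : M ≤ N) (y : ℕ) :
    (Nat.smoothNumbersUpTo M y).card ≤ (Nat.smoothNumbersUpTo N y).card := by
  apply Finset.card_le_card
  intro s hs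
  rw [Nat.mem_smoothNumbersUpTo] at hs ⊢
  exact ⟨hs.1.trans h, hs.2⟩

lemma card_smoothNumbersUpTo_zero (y : ℕ) : (Nat.smoothNumbersUpTo 0 y).card = 0 := by
  rw [Finset.card_eq_zero, Finset.eq_empty_iff_forall_notMem]
  intro s hs
  rw [Nat.mem_smoothNumbersUpTo] at hs
  exact Nat.ne_zero_of_mem_smoothNumbers hs.2 (Nat.le_zero.1 hs.1)

lemma card_smoothNumbersUpTo_sdiff {M N : ℕ} (h : M ≤ N) (y : ℕ) :
    (Nat.smoothNumbersUpTo N y \ Nat.smoothNumbersUpTo M y).card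
      + (Nat.smoothNumbersUpTo M y).card = (Nat.smoothNumbersUpTo N y).card := by
  apply Finset.card_sdiff_add_card_eq_card
  intro s hs
  rw [Nat.mem_smoothNumbersUpTo] at hs ⊢
  exact ⟨hs.1.trans h, hs.2⟩

/-- Multiplying the smooth numbers in `(n / (9q), n / q]` by `q` and passing to the chosen multiples
gives `q` times distinct smooth numbers in `(Kn / q, 3Kn / q]`. -/
lemma card_smooth_window_le {n K q : ℕ} (hq : 0 < q) (hf : f n (K * n) ≤ 2 * (K * n)) :
    (Nat.smoothNumbersUpTo (n / q) (27 * K)).card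
        + (Nat.smoothNumbersUpTo (K * n / q) (27 * K)).card
      ≤ (Nat.smoothNumbersUpTo (3 * (K * n) / q) (27 * K)).card
        + (Nat.smoothNumbersUpTo (n / (9 * q)) (27 * K)).card := by
  obtain ⟨a, hdvd, hbd, hinj⟩ := exists_multiples_of_f n (K * n)
  set y := 27 * K with hy
  have h1 := card_smoothNumbersUpTo_sdiff
    (Nat.div_le_div_left (Nat.le_mul_of_pos_left q (by norm_num : 0 < 9)) hq : n / (9 * q) ≤ n / q) y
  have h2 := card_smoothNumbersUpTo_sdiff
    (Nat.div_le_div_right (by lia) : K * n / q ≤ 3 * (K * n) / q) y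
  suffices h : (Nat.smoothNumbersUpTo (n / q) y \ Nat.smoothNumbersUpTo (n / (9 * q)) y).card ≤
      (Nat.smoothNumbersUpTo (3 * (K * n) / q) y \ Nat.smoothNumbersUpTo (K * n / q) y).card by
    lia
  have key : ∀ s ∈ Nat.smoothNumbersUpTo (n / q) y \ Nat.smoothNumbersUpTo (n / (9 * q)) y,
      s * q ∈ Finset.Icc 1 n ∧ n < s * (9 * q) ∧ s ∈ Nat.smoothNumbers y := by
    intro s hs
    rw [Finset.mem_sdiff, Nat.mem_smoothNumbersUpTo, Nat.mem_smoothNumbersUpTo] at hs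
    obtain ⟨⟨hs1, hs2⟩, hs3⟩ := hs
    have hs0 : 0 < s := Nat.pos_of_ne_zero (Nat.ne_zero_of_mem_smoothNumbers hs2)
    have hs4 : n / (9 * q) < s := by
      by_contra hcon
      exact hs3 ⟨not_lt.1 hcon, hs2⟩
    rw [Nat.div_lt_iff_lt_mul (by positivity)] at hs4
    rw [Nat.le_div_iff_mul_le hq] at hs1
    exact ⟨Finset.mem_Icc.2 ⟨Nat.mul_pos hs0 hq, hs1⟩, hs4, hs2⟩
  apply Finset.card_le_card_of_injOn (fun s => a (s * q) / q)
  · intro s hs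
    obtain ⟨hmem, hlt, hsm⟩ := key s hs
    obtain ⟨b, hb⟩ := hdvd _ hmem
    obtain ⟨hlo, hhi⟩ := hbd _ hmem
    have hquot : a (s * q) / q = s * b := by
      rw [hb, mul_right_comm, Nat.mul_div_cancel _ hq]
    have hb0 : 0 < b := by
      rcases Nat.eq_zero_or_pos b with h | h
      · rw [h, mul_zero] at hb; lia
      · exact h
    have hby : b < y := by
      have h3 : s * q * b ≤ 3 * (K * n) := by rw [← hb]; lia
      have h4 : 0 < K := by
        rcases Nat.eq_zero_or_pos K with h | h
        · have : 0 < s * q * b := Nat.mul_pos (Finset.mem_Icc.1 hmem).1 hb0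
          rw [h] at h3; lia
        · exact h
      have h5 : s * q * b < s * q * (27 * K) := by nlinarith
      exact lt_of_mul_lt_mul_left h5 (Nat.zero_le _)
    have hsb : s * b ∈ Nat.smoothNumbers y :=
      Nat.mul_mem_smoothNumbers hsm (Nat.mem_smoothNumbers_of_lt hb0 hby)
    simp only [Finset.coe_sdiff, Set.mem_sdiff, Finset.mem_coe, Nat.mem_smoothNumbersUpTo, hquot]
    have hsbq : s * b * q = a (s * q) := by rw [hb]; ring
    refine ⟨⟨?_, hsb⟩, fun h => ?_⟩
    · rw [Nat.le_div_iff_mul_le hq, hsbq]; lia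
    · have := h.1
      rw [Nat.le_div_iff_mul_le hq, hsbq] at this; lia
  · intro s hs t ht hst
    obtain ⟨hsm, -, -⟩ := key s hs
    obtain ⟨htm, -, -⟩ := key t ht
    have hs' : q ∣ a (s * q) := (Dvd.intro_left s rfl).trans (hdvd _ hsm)
    have ht' : q ∣ a (t * q) := (Dvd.intro_left t rfl).trans (hdvd _ htm)
    have h : a (s * q) = a (t * q) := (Nat.div_left_inj hs' ht').1 hst
    exact Nat.eq_of_mul_eq_mul_right hq (hinj hsm htm h)

lemma card_smooth_telescope {n K Q : ℕ} (hQ : 0 < Q) (hf : f n (K * n) ≤ 2 * (K * n)) (E : ℕ) :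
    (Nat.smoothNumbersUpTo (n / Q) (27 * K)).card
        + (Nat.smoothNumbersUpTo (n / (3 * Q)) (27 * K)).card
        + (Nat.smoothNumbersUpTo (K * n / (3 ^ E * Q)) (27 * K)).card
      ≤ (Nat.smoothNumbersUpTo (3 * (K * n) / Q) (27 * K)).card
        + (Nat.smoothNumbersUpTo (n / (3 ^ (E + 1) * Q)) (27 * K)).card
        + (Nat.smoothNumbersUpTo (n / (3 ^ (E + 2) * Q)) (27 * K)).card := by
  induction E with
  | zero =>
    have := card_smooth_window_le hQ hf
    simp only [pow_zero, one_mul, zero_add, pow_one]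
    norm_num
    lia
  | succ E ih =>
    have h := card_smooth_window_le (q := 3 ^ (E + 1) * Q) (by positivity) hf
    have e1 : 3 * (K * n) / (3 ^ (E + 1) * Q) = K * n / (3 ^ E * Q) := by
      rw [pow_succ', mul_assoc, Nat.mul_div_mul_left _ _ (by norm_num)]
    have e2 : 9 * (3 ^ (E + 1) * Q) = 3 ^ (E + 3) * Q := by ring
    rw [e1, e2] at h
    lia

lemma card_smooth_add_le {n K Q : ℕ} (hQ : 0 < Q) (hf : f n (K * n) ≤ 2 * (K * n)) :
    (Nat.smoothNumbersUpTo (n / Q) (27 * K)).card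
        + (Nat.smoothNumbersUpTo (n / (3 * Q)) (27 * K)).card
      ≤ (Nat.smoothNumbersUpTo (3 * (K * n) / Q) (27 * K)).card := by
  have h := card_smooth_telescope hQ hf n
  have hn : ∀ j, n / (3 ^ (n + j) * Q) = 0 := fun j => by
    apply Nat.div_eq_of_lt
    calc n < 3 ^ n := Nat.lt_pow_self (by norm_num)
      _ ≤ 3 ^ (n + j) := Nat.pow_le_pow_right (by norm_num) (Nat.le_add_right _ _)
      _ ≤ 3 ^ (n + j) * Q := Nat.le_mul_of_pos_right _ hQ
  rw [hn, hn, card_smoothNumbersUpTo_zero] at h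
  lia

/-- If `(Kn, 3Kn]` contains distinct multiples of `1, ..., n`, then the number of smooth numbers
at least doubles at every multiplication of the argument by `9K`. -/
lemma two_pow_le_card_smooth {n K J : ℕ} (hK : 0 < K) (hf : f n (K * n) ≤ 2 * (K * n))
    (hJ : 3 * (9 * K) ^ J ≤ n) :
    2 ^ J ≤ (Nat.smoothNumbersUpTo n (27 * K)).card := by
  have main : ∀ j, 2 ^ j * (Nat.smoothNumbersUpTo (n / (3 * (9 * K) ^ j)) (27 * K)).card
      ≤ (Nat.smoothNumbersUpTo n (27 * K)).card := by
    intro j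
    induction j with
    | zero => simpa using card_smoothNumbersUpTo_mono (Nat.div_le_self n 3) (27 * K)
    | succ j ih =>
      have h := card_smooth_add_le (Q := (9 * K) ^ (j + 1)) (by positivity) hf
      have e : 3 * (K * n) / (9 * K) ^ (j + 1) = n / (3 * (9 * K) ^ j) := by
        rw [show (9 * K) ^ (j + 1) = 3 * K * (3 * (9 * K) ^ j) by ring, ← mul_assoc 3 K n,
          Nat.mul_div_mul_left _ _ (by positivity)]
      rw [e] at h
      have h2 := card_smoothNumbersUpTo_mono (Nat.div_le_div_left
        (Nat.le_mul_of_pos_left ((9 * K) ^ (j + 1)) (by norm_num : 0 < 3)) (by positivity) :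
          n / (3 * (9 * K) ^ (j + 1)) ≤ n / (9 * K) ^ (j + 1)) (27 * K)
      rw [pow_succ, mul_assoc]
      exact (Nat.mul_le_mul_left _ (by lia)).trans ih
  refine le_trans (Nat.le_mul_of_pos_right _ (Finset.card_pos.2 ⟨1, ?_⟩)) (main J)
  rw [Nat.mem_smoothNumbersUpTo]
  exact ⟨(Nat.le_div_iff_mul_le (by positivity)).2 (by lia),
    Nat.mem_smoothNumbers_of_lt one_pos (by lia)⟩

/-- Rankin's bound for the number of smooth numbers. -/
lemma card_smooth_le_rankin {n y : ℕ} {σ : ℝ} (hσ : 0 < σ) (hn : 0 < n) :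
    ((Nat.smoothNumbersUpTo n y).card : ℝ)
      ≤ (n : ℝ) ^ σ * ((1 - (2 : ℝ) ^ (-σ))⁻¹) ^ (Nat.primesBelow y).card := by
  let g : ℕ →* ℝ :=
    { toFun := fun m => (m : ℝ) ^ (-σ)
      map_one' := by simp
      map_mul' := fun a b => by
        push_cast
        exact Real.mul_rpow (Nat.cast_nonneg a) (Nat.cast_nonneg b) }
  have hg : ∀ m : ℕ, g m = (m : ℝ) ^ (-σ) := fun _ => rfl
  have hg0 : ∀ m : ℕ, 0 ≤ g m := fun m => by rw [hg]; positivity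
  have h2 : ∀ p : ℕ, 2 ≤ p → g p ≤ (2 : ℝ) ^ (-σ) := fun p hp => by
    rw [hg]
    exact Real.rpow_le_rpow_of_nonpos (by norm_num) (by exact_mod_cast hp) (by linarith)
  have h21 : (2 : ℝ) ^ (-σ) < 1 := Real.rpow_lt_one_of_one_lt_of_neg (by norm_num) (by linarith)
  obtain ⟨hsum, hhas⟩ :=
    EulerProduct.summable_and_hasSum_smoothNumbers_prod_primesBelow_geometric (f := g)
    (fun {p} hp => by
      rw [Real.norm_of_nonneg (hg0 p)]
      exact (h2 p hp.two_le).trans_lt h21) y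
  have hprod : ∏ p ∈ Nat.primesBelow y, (1 - g p)⁻¹
      ≤ ((1 - (2 : ℝ) ^ (-σ))⁻¹) ^ (Nat.primesBelow y).card := by
    rw [← Finset.prod_const]
    apply Finset.prod_le_prod
    · intro p hp
      have := h2 p (Nat.two_le_of_mem_primesBelow hp)
      exact inv_nonneg.2 (by linarith)
    · intro p hp
      have := h2 p (Nat.two_le_of_mem_primesBelow hp)
      exact inv_anti₀ (by linarith) (by linarith)
  have hfin : ∑ m ∈ Nat.smoothNumbersUpTo n y, g m ≤ ∏ p ∈ Nat.primesBelow y, (1 - g p)⁻¹ := by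
    rw [← Finset.sum_subtype_of_mem (p := (· ∈ Nat.smoothNumbers y)) g
      (fun m hm => (Nat.mem_smoothNumbersUpTo.1 hm).2)]
    exact sum_le_hasSum _ (fun m _ => hg0 m) hhas
  have hlow : ((Nat.smoothNumbersUpTo n y).card : ℝ) * (n : ℝ) ^ (-σ)
      ≤ ∑ m ∈ Nat.smoothNumbersUpTo n y, g m := by
    rw [← nsmul_eq_mul]
    apply Finset.card_nsmul_le_sum
    intro m hm
    rw [Nat.mem_smoothNumbersUpTo] at hm
    have hm0 := Nat.pos_of_ne_zero (Nat.ne_zero_of_mem_smoothNumbers hm.2)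
    rw [hg]
    exact Real.rpow_le_rpow_of_nonpos (by exact_mod_cast hm0) (by exact_mod_cast hm.1)
      (by linarith)
  have hn' : (0 : ℝ) < (n : ℝ) ^ σ := by positivity
  have := (hlow.trans hfin).trans hprod
  rw [Real.rpow_neg (Nat.cast_nonneg n), ← div_eq_mul_inv, div_le_iff₀ hn'] at this
  linarith

lemma two_pow_card_le_of_forall_prime_dvd {s : Finset ℕ} {a : ℕ} (ha : 0 < a)
    (hs : ∀ p ∈ s, p.Prime ∧ p ∣ a) : 2 ^ s.card ≤ a := by
  have h1 : ∏ p ∈ s, p ∣ a := Finset.prod_primes_dvd a (fun p hp => (hs p hp).1.prime)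
    (fun p hp => (hs p hp).2)
  calc 2 ^ s.card = ∏ _p ∈ s, 2 := by rw [Finset.prod_const]
    _ ≤ ∏ p ∈ s, p := Finset.prod_le_prod' fun p hp => (hs p hp).1.two_le
    _ ≤ a := Nat.le_of_dvd ha h1

/-- Matching small integers `i` with their prime multiples in `(M, 8M]`. -/
lemma exists_prime_multiples {N M d : ℕ} (hd : 8 * M < 2 ^ (d + 1)) (hd0 : 0 < d)
    (hprime : ∀ i ∈ Finset.Icc 1 N,
      d ≤ ((Finset.Ioc (M / i) (8 * (M / i))).filter Nat.Prime).card) :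
    ∃ g : ℕ → ℕ, (∀ i ∈ Finset.Icc 1 N, i ∣ g i ∧ M < g i ∧ g i ≤ 8 * M) ∧
      Set.InjOn g (Finset.Icc 1 N) := by
  classical
  let t : Finset.Icc 1 N → Finset ℕ := fun i =>
    ((Finset.Ioc (M / i.1) (8 * (M / i.1))).filter Nat.Prime).image (fun p => i.1 * p)
  have hpos : ∀ i : Finset.Icc 1 N, 0 < i.1 := fun i => (Finset.mem_Icc.1 i.2).1
  have hcard : ∀ i, d ≤ (t i).card := fun i => by
    rw [Finset.card_image_of_injective _ (fun a b h => Nat.eq_of_mul_eq_mul_left (hpos i) h)]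
    exact hprime i.1 i.2
  have ht : ∀ i, ∀ b ∈ t i, ∃ p, p.Prime ∧ b = i.1 * p ∧ M < b ∧ b ≤ 8 * M := by
    intro i b hb
    obtain ⟨p, hp, rfl⟩ := Finset.mem_image.1 hb
    rw [Finset.mem_filter, Finset.mem_Ioc, Nat.div_lt_iff_lt_mul (hpos i)] at hp
    refine ⟨p, hp.2, rfl, by lia, ?_⟩
    calc i.1 * p ≤ i.1 * (8 * (M / i.1)) := Nat.mul_le_mul_left _ hp.1.2
      _ = 8 * (M / i.1 * i.1) := by ring
      _ ≤ 8 * M := Nat.mul_le_mul_left _ (Nat.div_mul_le_self _ _)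
  have hall : ∀ s : Finset (Finset.Icc 1 N), s.card ≤ (s.biUnion t).card := by
    intro s
    have h := Finset.card_mul_le_card_mul (s := s) (t := s.biUnion t) (m := d) (n := d)
      (fun i b => b ∈ t i) ?_ ?_
    · exact Nat.le_of_mul_le_mul_right h hd0
    · intro i hi
      refine (hcard i).trans (Finset.card_le_card fun b hb => ?_)
      rw [Finset.mem_bipartiteAbove]
      exact ⟨Finset.mem_biUnion.2 ⟨i, hi, hb⟩, hb⟩
    · intro b hb
      obtain ⟨i₀, -, hi₀⟩ := Finset.mem_biUnion.1 hb
      obtain ⟨-, -, -, hlo, hhi⟩ := ht i₀ b hi₀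
      have hb0 : 0 < b := by lia
      have hq : ∀ i ∈ s.bipartiteBelow (fun i b => b ∈ t i) b,
          (b / i.1).Prime ∧ i.1 * (b / i.1) = b := by
        intro i hi
        obtain ⟨p, hp, hbp, -⟩ := ht i b ((Finset.mem_bipartiteBelow _).1 hi).2
        have : b / i.1 = p := by rw [hbp, Nat.mul_div_cancel_left _ (hpos i)]
        rw [this]
        exact ⟨hp, hbp.symm⟩
      have hinj : Set.InjOn (fun i : Finset.Icc 1 N => b / i.1)
          (s.bipartiteBelow (fun i b => b ∈ t i) b) := by
        intro i hi j hj hij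
        have h1 := (hq i hi).2
        have h2 := (hq j hj).2
        simp only at hij
        rw [hij] at h1
        exact Subtype.ext (Nat.eq_of_mul_eq_mul_right (hq j hj).1.pos (h1.trans h2.symm))
      rw [← Finset.card_image_of_injOn hinj]
      have := two_pow_card_le_of_forall_prime_dvd
        (s := (s.bipartiteBelow (fun i b => b ∈ t i) b).image (fun i => b / i.1)) hb0 ?_
      · have h3 := (this.trans hhi).trans_lt hd
        have := (Nat.pow_lt_pow_iff_right (by norm_num : 1 < 2)).1 h3
        lia
      · intro p hp
        obtain ⟨i, hi, rfl⟩ := Finset.mem_image.1 hp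
        exact ⟨(hq i hi).1, Dvd.intro_left _ (hq i hi).2⟩
  obtain ⟨g, hginj, hg⟩ := (Finset.all_card_le_biUnion_card_iff_exists_injective t).1 hall
  refine ⟨fun i => if h : i ∈ Finset.Icc 1 N then g ⟨i, h⟩ else 0, ?_, ?_⟩
  · intro i hi
    obtain ⟨p, -, hp, hlo, hhi⟩ := ht _ _ (hg ⟨i, hi⟩)
    simp only [dif_pos hi]
    exact ⟨Dvd.intro _ hp.symm, hlo, hhi⟩
  · intro i hi j hj hij
    rw [Finset.mem_coe] at hi hj
    simp only [dif_pos hi, dif_pos hj] at hij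
    exact congrArg Subtype.val (hginj hij)

lemma f_self_le {n T d : ℕ} (hd : 8 * (2 ^ T * n) < 2 ^ (d + 1)) (hd0 : 0 < d)
    (hprime : ∀ x, 4 ^ T ≤ x → d ≤ ((Finset.Ioc x (8 * x)).filter Nat.Prime).card) :
    f n n ≤ 8 * (2 ^ T * n) := by
  obtain ⟨g, hg, hginj⟩ := exists_prime_multiples (N := n / 2 ^ T) hd hd0 (fun i hi => by
    apply hprime
    rw [Finset.mem_Icc, Nat.le_div_iff_mul_le (by positivity)] at hi
    rw [Nat.le_div_iff_mul_le hi.1, show (4 : ℕ) ^ T = 2 ^ T * 2 ^ T by rw [← mul_pow]; norm_num, mul_assoc]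
    exact Nat.mul_le_mul_left _ (by lia))
  have hlarge : ∀ i, 0 < i → n / 2 ^ T < i →
      n / i < 2 ^ T := fun i hi h => by
    rw [Nat.div_lt_iff_lt_mul (by positivity)] at h
    rw [Nat.div_lt_iff_lt_mul hi]
    lia
  have hlog : ∀ i, 0 < i → i ≤ n →
      2 ^ Nat.log 2 (n / i) * n < 2 * 4 ^ Nat.log 2 (n / i) * i ∧
      2 * 4 ^ Nat.log 2 (n / i) * i ≤ 2 ^ (Nat.log 2 (n / i) + 1) * n := fun i hi hin => by
    have h0 : n / i ≠ 0 := (Nat.div_pos hin hi).ne'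
    have h1 := Nat.pow_log_le_self 2 h0
    have h2 := Nat.lt_pow_succ_log_self (by norm_num : 1 < 2) (n / i)
    rw [Nat.le_div_iff_mul_le hi] at h1
    rw [Nat.div_lt_iff_lt_mul hi] at h2
    set l := Nat.log 2 (n / i)
    have h3 : 2 * 4 ^ l * i = 2 ^ l * (2 ^ l.succ * i) := by
      rw [show (4 : ℕ) ^ l = 2 ^ l * 2 ^ l by rw [← mul_pow]; norm_num, Nat.succ_eq_add_one]; ring
    have h4 : 2 * 4 ^ l * i = 2 ^ (l + 1) * (2 ^ l * i) := by
      rw [h3, Nat.succ_eq_add_one]; ring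
    refine ⟨?_, ?_⟩
    · rw [h3]; exact Nat.mul_lt_mul_of_pos_left h2 (by positivity)
    · rw [h4]; exact Nat.mul_le_mul_left _ h1
  have hmid : ∀ i, 0 < i → i ≤ n → n / 2 ^ T < i →
      2 * 4 ^ Nat.log 2 (n / i) * i ≤ 2 ^ T * n := fun i hi hin h => by
    refine (hlog i hi hin).2.trans (Nat.mul_le_mul_right _ (Nat.pow_le_pow_right (by norm_num) ?_))
    exact Nat.log_lt_of_lt_pow (Nat.div_pos hin hi).ne' (hlarge i hi h)
  have hT : n ≤ 2 ^ T * n := Nat.le_mul_of_pos_left n (by positivity)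
  refine Nat.sInf_le ⟨fun i => if i ≤ n / 2 ^ T then g i else 2 * 4 ^ Nat.log 2 (n / i) * i,
    ?_, ?_, ?_⟩
  · intro i hi
    rw [Finset.mem_Icc] at hi
    by_cases h : i ≤ n / 2 ^ T
    · simp only [if_pos h]
      exact (hg i (Finset.mem_Icc.2 ⟨hi.1, h⟩)).1
    · simp only [if_neg h]
      exact Dvd.intro_left _ rfl
  · intro i hi
    rw [Finset.mem_Icc] at hi
    by_cases h : i ≤ n / 2 ^ T
    · simp only [if_pos h]
      have := (hg i (Finset.mem_Icc.2 ⟨hi.1, h⟩)).2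
      lia
    · simp only [if_neg h]
      have h1 := hmid i hi.1 hi.2 (not_le.1 h)
      have h2 := (hlog i hi.1 hi.2).1
      have h3 : n ≤ 2 ^ Nat.log 2 (n / i) * n := Nat.le_mul_of_pos_left n (by positivity)
      lia
  · intro i hi j hj hij
    rw [Finset.mem_coe, Finset.mem_Icc] at hi hj
    by_cases h : i ≤ n / 2 ^ T <;> by_cases h' : j ≤ n / 2 ^ T
    · simp only [if_pos h, if_pos h'] at hij
      exact hginj (Finset.mem_coe.2 (Finset.mem_Icc.2 ⟨hi.1, h⟩))
        (Finset.mem_coe.2 (Finset.mem_Icc.2 ⟨hj.1, h'⟩)) hij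
    · simp only [if_pos h, if_neg h'] at hij
      have h1 := (hg i (Finset.mem_Icc.2 ⟨hi.1, h⟩)).2.1
      have h2 := hmid j hj.1 hj.2 (not_le.1 h')
      lia
    · simp only [if_neg h, if_pos h'] at hij
      have h1 := (hg j (Finset.mem_Icc.2 ⟨hj.1, h'⟩)).2.1
      have h2 := hmid i hi.1 hi.2 (not_le.1 h)
      lia
    · simp only [if_neg h, if_neg h'] at hij
      have hi' := hlog i hi.1 hi.2
      have hj' := hlog j hj.1 hj.2
      have hn : 0 < n := by lia
      have hll : Nat.log 2 (n / i) = Nat.log 2 (n / j) := by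
        have h1 := lt_of_mul_lt_mul_right (hi'.1.trans_le (hij ▸ hj'.2)) (Nat.zero_le n)
        have h2 := lt_of_mul_lt_mul_right (hj'.1.trans_le (hij.symm ▸ hi'.2)) (Nat.zero_le n)
        have h1' := (Nat.pow_lt_pow_iff_right (by norm_num : 1 < 2)).1 h1
        have h2' := (Nat.pow_lt_pow_iff_right (by norm_num : 1 < 2)).1 h2
        lia
      rw [hll] at hij
      exact Nat.eq_of_mul_eq_mul_left (by positivity) hij

lemma theta_sub_theta_le (x : ℕ) :
    Chebyshev.theta ((8 * x : ℕ) : ℝ) - Chebyshev.theta (x : ℝ)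
      ≤ ((Finset.Ioc x (8 * x)).filter Nat.Prime).card * Real.log ((8 * x : ℕ) : ℝ) := by
  rw [Chebyshev.theta, Chebyshev.theta, Nat.floor_natCast, Nat.floor_natCast,
    ← Finset.Ioc_union_Ioc_eq_Ioc (Nat.zero_le x) (by lia : x ≤ 8 * x), Finset.filter_union,
    Finset.sum_union, add_sub_cancel_left, ← nsmul_eq_mul]
  · apply Finset.sum_le_card_nsmul
    intro p hp
    rw [Finset.mem_filter, Finset.mem_Ioc] at hp
    exact Real.log_le_log (by exact_mod_cast hp.2.pos) (by exact_mod_cast hp.1.2)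
  · rw [Finset.disjoint_left]
    intro p hp hp'
    rw [Finset.mem_filter, Finset.mem_Ioc] at hp hp'
    lia

lemma eventually_rpow_le_card_primes_Ioc :
    ∀ᶠ x : ℕ in Filter.atTop,
      (x : ℝ) ^ (5 / 6 : ℝ) ≤ ((Finset.Ioc x (8 * x)).filter Nat.Prime).card := by
  have hz : Filter.Tendsto (fun x : ℕ => ((8 * x : ℕ) : ℝ)) Filter.atTop Filter.atTop :=
    tendsto_natCast_atTop_atTop.comp (Filter.tendsto_id.const_mul_atTop' (by norm_num))
  have h1 := hz.eventually ((isLittleO_log_rpow_atTop (by norm_num : (0 : ℝ) < 1 / 2)).bound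
    (by norm_num : (0 : ℝ) < 1 / 32))
  have h2 := hz.eventually ((isLittleO_log_rpow_atTop (by norm_num : (0 : ℝ) < 1 / 6)).bound
    (by norm_num : (0 : ℝ) < 1 / 2))
  filter_upwards [h1, h2, Filter.eventually_ge_atTop 2] with x h1 h2 hx
  have hx' : (2 : ℝ) ≤ x := by exact_mod_cast hx
  have hxx : ((8 * x : ℕ) : ℝ) = 8 * x := by push_cast; ring
  have hcount := theta_sub_theta_le x
  have hlo := Chebyshev.theta_ge (8 * x)
  have hup := Chebyshev.theta_le_log4_mul_x (x := (x : ℝ)) (by positivity)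
  rw [hxx] at h1 h2 hcount hlo
  set z : ℝ := 8 * x with hzdef
  have hz0 : 1 ≤ z := by linarith
  have hlogz : 0 < Real.log z := Real.log_pos (by linarith)
  rw [Real.norm_of_nonneg hlogz.le, Real.norm_of_nonneg (by positivity)] at h1 h2
  rw [← Real.sqrt_eq_rpow] at h1
  have hsq : √z * √z = z := Real.mul_self_sqrt (by linarith)
  have hs1 : 1 ≤ √z := Real.one_le_sqrt.2 hz0
  have hA : 2 * √z * Real.log z ≤ x / 2 := by nlinarith
  have hB : Real.log (z + 1) ≤ x / 4 + 1 := by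
    calc Real.log (z + 1) ≤ Real.log (2 * z) := Real.log_le_log (by linarith) (by linarith)
      _ = Real.log 2 + Real.log z := Real.log_mul (by norm_num) (by linarith)
      _ ≤ x / 4 + 1 := by nlinarith [Real.log_two_lt_d9]
  have hl4 : Real.log 4 = 2 * Real.log 2 := by
    rw [show (4 : ℝ) = 2 ^ 2 by norm_num, Real.log_pow]; norm_num
  rw [hl4] at hup
  have hmain : (x : ℝ) ≤ ((Finset.Ioc x (8 * x)).filter Nat.Prime).card * Real.log z := by
    nlinarith [Real.log_two_gt_d9]
  have hC : Real.log z ≤ (x : ℝ) ^ (1 / 6 : ℝ) := by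
    have h8 : (8 : ℝ) ^ (1 / 6 : ℝ) ≤ 2 := by
      calc (8 : ℝ) ^ (1 / 6 : ℝ) ≤ (2 ^ (6 : ℝ)) ^ (1 / 6 : ℝ) :=
            Real.rpow_le_rpow (by norm_num) (by norm_num) (by norm_num)
        _ = 2 := by rw [← Real.rpow_mul (by norm_num)]; norm_num
    rw [hzdef, Real.mul_rpow (by norm_num) (by positivity), ← hzdef] at h2
    have : (0 : ℝ) ≤ (x : ℝ) ^ (1 / 6 : ℝ) := by positivity
    nlinarith
  have hx6 : (0 : ℝ) < (x : ℝ) ^ (1 / 6 : ℝ) := by positivity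
  have hsplit : (x : ℝ) ^ (5 / 6 : ℝ) * (x : ℝ) ^ (1 / 6 : ℝ) = x := by
    rw [← Real.rpow_add (by linarith)]; norm_num
  refine le_of_mul_le_mul_right ?_ hx6
  rw [hsplit]
  exact hmain.trans (mul_le_mul_of_nonneg_left hC (Nat.cast_nonneg _))

lemma tendsto_log_natCast_atTop :
    Filter.Tendsto (fun n : ℕ => Real.log n) Filter.atTop Filter.atTop :=
  Real.tendsto_log_atTop.comp tendsto_natCast_atTop_atTop

lemma eventually_f_self_le :
    ∀ᶠ n : ℕ in Filter.atTop,
      (f n n : ℝ) ≤ 0.36 * n * (Real.log n / Real.log (Real.log n)) := by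
  obtain ⟨X, hX⟩ := Filter.eventually_atTop.1 eventually_rpow_le_card_primes_Ioc
  have h1 := tendsto_log_natCast_atTop.eventually
    ((isLittleO_log_rpow_atTop (by norm_num : (0 : ℝ) < 1 / 4)).bound
    (by norm_num : (0 : ℝ) < 1 / 50))
  have h2 := tendsto_log_natCast_atTop.eventually
    ((tendsto_rpow_atTop (by norm_num : (0 : ℝ) < 1 / 4)).eventually_ge_atTop 8)
  have h3 := tendsto_log_natCast_atTop.eventually
    ((tendsto_rpow_atTop (by norm_num : (0 : ℝ) < 3 / 2)).eventually_ge_atTop X)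
  filter_upwards [h1, h2, h3, tendsto_log_natCast_atTop.eventually_ge_atTop 16,
    Filter.eventually_ge_atTop 1] with n h1 h2 h3 h4 hn
  have hn' : (1 : ℝ) ≤ n := by exact_mod_cast hn
  set G := Real.log n with hG
  have hG0 : 0 < G := by linarith
  have hl0 : 0 < Real.log G := Real.log_pos (by linarith)
  rw [Real.norm_of_nonneg hl0.le, Real.norm_of_nonneg (by positivity)] at h1
  set v := G ^ (1 / 4 : ℝ) with hv
  have hv4 : G = v ^ 4 := by
    rw [hv, ← Real.rpow_natCast, ← Real.rpow_mul hG0.le]; norm_num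
  have hW : G ^ (3 / 4 : ℝ) = v ^ 3 := by
    rw [hv, ← Real.rpow_natCast, ← Real.rpow_mul hG0.le]; norm_num
  have h32 : G ^ (3 / 2 : ℝ) = v ^ 3 * v ^ 3 := by
    rw [← hW, ← Real.rpow_add hG0]; norm_num
  have h54 : (G ^ (3 / 2 : ℝ)) ^ (5 / 6 : ℝ) = v ^ 5 := by
    rw [hv, ← Real.rpow_natCast, ← Real.rpow_mul hG0.le, ← Real.rpow_mul hG0.le]; norm_num
  obtain ⟨t, ht1, ht2⟩ := exists_nat_pow_near (one_le_pow₀ (by linarith : 1 ≤ v) : 1 ≤ v ^ 3)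
    (by norm_num : (1 : ℝ) < 2)
  set T := t + 1 with hT
  have hT2 : (2 : ℝ) ^ T ≤ 2 * v ^ 3 := by rw [hT, pow_succ]; linarith
  have h4T : G ^ (3 / 2 : ℝ) ≤ (4 : ℝ) ^ T := by
    rw [h32, show (4 : ℝ) = 2 * 2 by norm_num, mul_pow]
    have : 0 ≤ v ^ 3 := by positivity
    exact mul_le_mul ht2.le ht2.le this (by positivity)
  set d := Nat.log 2 (8 * (2 ^ T * n)) with hd
  have hpos : 8 ≤ 8 * (2 ^ T * n) := Nat.le_mul_of_pos_right 8 (by positivity)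
  have hd0 : 0 < d := Nat.log_pos (by norm_num) (by lia)
  have hdle : (d : ℝ) ≤ v ^ 5 := by
    have h5 : (2 : ℝ) ^ d ≤ 8 * (2 ^ T * n) := by
      exact_mod_cast Nat.pow_log_le_self 2 (by lia : 8 * (2 ^ T * n) ≠ 0)
    have h6 := Real.log_le_log (by positivity) h5
    rw [Real.log_pow, Real.log_mul (by norm_num) (by positivity),
      Real.log_mul (by positivity) (by positivity), ← hG] at h6
    have h7 : Real.log ((2 : ℝ) ^ T) ≤ G := by
      have h8 : Real.log ((2 : ℝ) ^ T) ≤ (2 : ℝ) ^ T := Real.log_le_self (by positivity)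
      nlinarith [pow_pos (by linarith : 0 < v) 3]
    have h9 : Real.log 8 ≤ 8 := Real.log_le_self (by norm_num)
    have h10 : v ^ 5 = v ^ 4 * v := by ring
    have : (d : ℝ) / 2 ≤ d * Real.log 2 := by
      nlinarith [Real.log_two_gt_d9, (Nat.cast_nonneg d : (0 : ℝ) ≤ d)]
    rw [h10, ← hv4]
    nlinarith
  have hf := f_self_le (n := n) (T := T) (d := d)
    (Nat.lt_pow_succ_log_self (by norm_num) _) hd0 (fun x hx => by
      have hx' : G ^ (3 / 2 : ℝ) ≤ x := h4T.trans (by exact_mod_cast hx)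
      have h5 := hX x (by exact_mod_cast h3.trans hx')
      have h6 := Real.rpow_le_rpow (by positivity) hx' (by norm_num : (0 : ℝ) ≤ 5 / 6)
      rw [h54] at h6
      exact_mod_cast (hdle.trans h6).trans h5)
  have hf' : (f n n : ℝ) ≤ 8 * (2 ^ T * n) := by exact_mod_cast hf
  have hgoal : 16 * v ^ 3 ≤ 0.36 * (G / Real.log G) := by
    rw [← mul_div_assoc, le_div_iff₀ hl0]
    have h5 : v ^ 3 * Real.log G ≤ v ^ 3 * (1 / 50 * v) :=
      mul_le_mul_of_nonneg_left h1 (by positivity)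
    have h6 : 0 < v ^ 4 := by positivity
    have h7 : v ^ 3 * (1 / 50 * v) = v ^ 4 / 50 := by ring
    rw [hv4] at *
    nlinarith
  calc (f n n : ℝ) ≤ 8 * (2 ^ T * n) := hf'
    _ ≤ (16 * v ^ 3) * n := by nlinarith
    _ ≤ (0.36 * (G / Real.log G)) * n := mul_le_mul_of_nonneg_right hgoal (by linarith)
    _ = _ := by ring

lemma card_primesBelow_le {K : ℕ} {L l : ℝ} (hl : 1 ≤ l) (hKL : (K : ℝ) ≤ L)
    (hL : 100 * l ^ 2 ≤ L) (hlog : l / 2 ≤ Real.log L) :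
    ((Nat.primesBelow (27 * K)).card : ℝ) ≤ 152 * L / l := by
  have hL0 : 0 < L := by nlinarith
  have hmono : (Nat.primesBelow (27 * K)).card ≤ Nat.primeCounting ⌊27 * L⌋₊ := by
    rw [← Nat.primesLE_card_eq_primeCounting]
    apply Finset.card_le_card
    intro p hp
    rw [Nat.mem_primesBelow] at hp
    rw [Nat.mem_primesLE]
    refine ⟨Nat.le_floor ?_, hp.2⟩
    have : (p : ℝ) ≤ 27 * K := by exact_mod_cast hp.1.le
    linarith
  have h1 := Chebyshev.pi_le_log4_mul_div (x := 27 * L) (by nlinarith)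
  have h2 : l / 4 ≤ Real.log √(27 * L) := by
    rw [Real.log_sqrt (by linarith)]
    have : Real.log L ≤ Real.log (27 * L) := Real.log_le_log hL0 (by linarith)
    linarith
  have hl4 : Real.log 4 ≤ 1.4 := by
    rw [show (4 : ℝ) = 2 ^ 2 by norm_num, Real.log_pow]
    norm_num
    linarith [Real.log_two_lt_d9]
  have h3 : Real.log 4 * (27 * L) / Real.log √(27 * L) ≤ 151.2 * L / l := by
    calc Real.log 4 * (27 * L) / Real.log √(27 * L) ≤ 1.4 * (27 * L) / (l / 4) := by
          gcongr
      _ = 151.2 * L / l := by field_simp; norm_num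
  have h4 : √(27 * L) ≤ 0.8 * L / l := by
    rw [Real.sqrt_le_left (by positivity), div_pow, le_div_iff₀ (by positivity)]
    nlinarith
  have h5 : 151.2 * L / l + 0.8 * L / l = 152 * L / l := by ring
  have h6 : ((Nat.primesBelow (27 * K)).card : ℝ) ≤ Nat.primeCounting ⌊27 * L⌋₊ := by
    exact_mod_cast hmono
  linarith

lemma inv_one_sub_two_rpow_neg_le {l : ℝ} (hl : 1 ≤ l) :
    (1 - (2 : ℝ) ^ (-(1 / (10 * l))))⁻¹ ≤ 21 * l := by
  set σ := 1 / (10 * l) with hσ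
  have hσ0 : 0 < σ := by positivity
  have h1 : 1 + σ / 2 ≤ (2 : ℝ) ^ σ := by
    rw [Real.rpow_def_of_pos (by norm_num)]
    have := Real.add_one_le_exp (Real.log 2 * σ)
    nlinarith [Real.log_two_gt_d9]
  have hσl : σ * l = 1 / 10 := by rw [hσ]; field_simp
  have h2 : (2 : ℝ) ^ (-σ) ≤ 1 / (1 + σ / 2) := by
    rw [Real.rpow_neg (by norm_num), ← one_div]
    exact one_div_le_one_div_of_le (by positivity) h1
  have h3 : (21 * l)⁻¹ ≤ 1 - 1 / (1 + σ / 2) := by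
    have : 1 - 1 / (1 + σ / 2) = σ / (2 + σ) := by field_simp; ring
    rw [this, inv_eq_one_div, div_le_div_iff₀ (by positivity) (by positivity)]
    nlinarith
  exact inv_le_of_inv_le₀ (by positivity) (h3.trans (by linarith))

lemma eventually_lt_f :
    ∀ᶠ n : ℕ in Filter.atTop, ∀ K : ℕ, 0 < K → (K : ℝ) ≤ Real.log n / Real.log (Real.log n) →
      2 * (K * n) < f n (K * n) := by
  have hll : Filter.Tendsto (fun n : ℕ => Real.log (Real.log n)) Filter.atTop Filter.atTop :=
    Real.tendsto_log_atTop.comp tendsto_log_natCast_atTop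
  have h1 := hll.eventually ((Real.tendsto_exp_div_pow_atTop 3).eventually_ge_atTop 100)
  have h2 := ((Filter.tendsto_id.const_mul_atTop (by norm_num : (0 : ℝ) < 21)).comp hll).eventually
    (Real.isLittleO_log_id_atTop.bound (by norm_num : (0 : ℝ) < 1 / (21 * 1520)))
  filter_upwards [h1, h2, hll.eventually_ge_atTop 9, tendsto_log_natCast_atTop.eventually_ge_atTop 1,
    Filter.eventually_ge_atTop 1] with n h1 h2 hl hG hn K hK hKL
  by_contra! hf
  have hn' : (1 : ℝ) ≤ n := by exact_mod_cast hn
  set G := Real.log n with hGdef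
  set l := Real.log G with hldef
  have hG0 : 0 < G := by linarith
  have hexp : Real.exp l = G := Real.exp_log hG0
  set L := G / l with hLdef
  have hGL : G = L * l := by rw [hLdef]; field_simp
  rw [hexp, le_div_iff₀ (by positivity)] at h1
  have hL : 100 * l ^ 2 ≤ L := by
    rw [hLdef, le_div_iff₀ (by linarith)]; nlinarith
  have hlog21 : Real.log (21 * l) ≤ l / 1520 := by
    simp only [Function.comp, id] at h2
    rw [Real.norm_of_nonneg (Real.log_nonneg (by linarith)),
      Real.norm_of_nonneg (by linarith)] at h2
    linarith
  have hloglL : l / 2 ≤ Real.log L := by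
    rw [hLdef, Real.log_div hG0.ne' (by linarith), ← hldef]
    have : Real.log l ≤ Real.log (21 * l) := Real.log_le_log (by linarith) (by linarith)
    linarith
  have hr := card_primesBelow_le (by linarith) hKL hL hloglL
  set r := (Nat.primesBelow (27 * K)).card
  set J := ⌊(G - 2) / l⌋₊ with hJdef
  have hG2 : 2 ≤ G := by nlinarith
  have hJle : (J : ℝ) * l ≤ G - 2 := by
    rw [← le_div_iff₀ (by linarith)]
    exact Nat.floor_le (div_nonneg (by linarith) (by linarith))
  have hJge : L - 2 ≤ J := by
    have h3 : (G - 2) / l < J + 1 := Nat.lt_floor_add_one _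
    have h4 : (G - 2) / l = L - 2 / l := by rw [hLdef]; ring
    have h5 : 2 / l ≤ 1 := by rw [div_le_one (by linarith)]; linarith
    linarith
  have hJn : 3 * (9 * K) ^ J ≤ n := by
    have h3 : (9 : ℝ) * K ≤ G := by
      have : 9 * L ≤ L * l := by nlinarith
      linarith
    have h4 : (3 : ℝ) * (9 * K) ^ J ≤ n := by
      calc (3 : ℝ) * (9 * K) ^ J ≤ 3 * G ^ J := by gcongr
        _ = 3 * Real.exp (J * l) := by rw [Real.exp_nat_mul, hexp]
        _ ≤ Real.exp 2 * Real.exp (G - 2) := by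
          gcongr
          linarith [Real.add_one_le_exp 2]
        _ = n := by
          rw [← Real.exp_add, add_sub_cancel, hGdef, Real.exp_log (by linarith)]
    exact_mod_cast h4
  have hΨ := two_pow_le_card_smooth hK hf hJn
  have hσ0 : 0 < 1 / (10 * l) := by positivity
  have hR := card_smooth_le_rankin (y := 27 * K) hσ0 hn
  have hB0 : 0 ≤ (1 - (2 : ℝ) ^ (-(1 / (10 * l))))⁻¹ := by
    rw [inv_nonneg, sub_nonneg]
    exact (Real.rpow_lt_one_of_one_lt_of_neg (by norm_num) (by linarith)).le
  have hfinal : (2 : ℝ) ^ J ≤ (n : ℝ) ^ (1 / (10 * l)) * (21 * l) ^ r := by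
    calc (2 : ℝ) ^ J ≤ ((Nat.smoothNumbersUpTo n (27 * K)).card : ℝ) := by exact_mod_cast hΨ
      _ ≤ _ := hR
      _ ≤ _ := by
        gcongr
        exact inv_one_sub_two_rpow_neg_le (by linarith)
  have hlogs := Real.log_le_log (by positivity) hfinal
  rw [Real.log_pow, Real.log_mul (by positivity) (by positivity), Real.log_rpow (by linarith),
    Real.log_pow, ← hGdef] at hlogs
  have h6 : 1 / (10 * l) * G = L / 10 := by rw [hLdef]; field_simp
  have h7 : (r : ℝ) * Real.log (21 * l) ≤ L / 10 := by
    calc (r : ℝ) * Real.log (21 * l) ≤ (152 * L / l) * (l / 1520) :=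
          mul_le_mul hr hlog21 (Real.log_nonneg (by linarith)) (by positivity)
      _ = L / 10 := by field_simp; ring
  nlinarith [Real.log_two_gt_d9]

theorem stmt_7 : ∃ N : ℕ, ∀ n : ℕ, N ≤ n → 0 < n →
    ∀ k : ℕ, k = ⌈0.6 * Real.sqrt (Real.log n / Real.log (Real.log n))⌉₊ →
      (f n (k ^ 2 * n) : ℝ) > (f n n : ℝ) + 0.36 * n * Real.log n / Real.log (Real.log n) := by
  have hL : ∀ᶠ n : ℕ in Filter.atTop, 9 ≤ Real.log n / Real.log (Real.log n) := by
    have h := tendsto_log_natCast_atTop.eventually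
      (Real.isLittleO_log_id_atTop.bound (by norm_num : (0 : ℝ) < 1 / 9))
    filter_upwards [h, tendsto_log_natCast_atTop.eventually_ge_atTop 2] with n h hn
    have hl : 0 < Real.log (Real.log n) := Real.log_pos (by linarith)
    rw [Real.norm_of_nonneg hl.le, id, Real.norm_of_nonneg (by linarith)] at h
    rw [le_div_iff₀ hl]
    linarith
  obtain ⟨N, hN⟩ := Filter.eventually_atTop.1 (hL.and (eventually_f_self_le.and eventually_lt_f))
  refine ⟨N, fun n hn _ k hk => ?_⟩
  obtain ⟨hL9, hself, hlt⟩ := hN n hn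
  rw [mul_div_assoc]
  set L := Real.log n / Real.log (Real.log n)
  have hs : √L * √L = L := Real.mul_self_sqrt (by linarith)
  have hs3 : 3 ≤ √L := Real.le_sqrt_of_sq_le (by linarith)
  have hk1 : 0.6 * √L ≤ k := by rw [hk]; exact Nat.le_ceil _
  have hk2 : (k : ℝ) < 0.6 * √L + 1 := by rw [hk]; exact Nat.ceil_lt_add_one (by positivity)
  have hk0 : 0 < k := by
    have : (0 : ℝ) < k := by linarith
    exact_mod_cast this
  have hkL : ((k ^ 2 : ℕ) : ℝ) ≤ L := by push_cast; nlinarith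
  have hkL' : 0.36 * L ≤ (k : ℝ) ^ 2 := by nlinarith
  have hmain : (2 : ℝ) * (k ^ 2 * n) < f n (k ^ 2 * n) := by
    exact_mod_cast hlt (k ^ 2) (by positivity) hkL
  have hmul : 0.36 * L * n ≤ (k : ℝ) ^ 2 * n := mul_le_mul_of_nonneg_right hkL' (Nat.cast_nonneg n)
  linarith
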